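/- Single-step type-substitution monotonicity (Lemma 1 / vsu-ext): if a configuration ⟨e, ρ, σ⟩ steps to ⟨e', ρ', σ'⟩ in the operational semantics, then σ' is an extension of σ: σ' = σ[α₁ ↦ t₁]…[αₙ ↦ tₙ]. Consequently, if along a trace of f applied to an initial hole the partial input type of f changes between two consecutive configurations, the later type substitution strictly extends the earlier one. -/

import Mathlib

/-- Types: t ::= Int | Bool | t × t | Tree t | Fun | α (type hole). -/
inductive Ty : Type where
  | int : Ty
  | bool : Ty
  | fn : Ty
  | prod (t₁ t₂ : Ty) : Ty
  | tree (t : Ty) : Ty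
  | hole (α : ℕ) : Ty
deriving DecidableEq

/-- A type substitution: a (partial) map from type holes to types. -/
abbrev TSub := ℕ → Option Ty

/-- Homomorphic application of a type substitution. -/
def Ty.subst (θ : TSub) : Ty → Ty
  | .int => .int
  | .bool => .bool
  | .fn => .fn
  | .prod t₁ t₂ => .prod (t₁.subst θ) (t₂.subst θ)
  | .tree t => .tree (t.subst θ)
  | .hole α => (θ α).getD (.hole α)

/-- s ∼ t : some substitution maps both to the same type. -/
def Compatible (s t : Ty) : Prop := ∃ θ : TSub, s.subst θ = t.subst θ

/-- s ⊑ t : some substitution maps t to s. -/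
def Refines (s t : Ty) : Prop := ∃ θ : TSub, s = t.subst θ

/-- Ground types contain no type holes. -/
def Ty.Ground : Ty → Prop
  | .int => True
  | .bool => True
  | .fn => True
  | .prod t₁ t₂ => t₁.Ground ∧ t₂.Ground
  | .tree t => t.Ground
  | .hole _ => False

/-- The set of type holes occurring in a type. -/
def Ty.holes : Ty → Set ℕ
  | .int => ∅
  | .bool => ∅
  | .fn => ∅
  | .prod t₁ t₂ => t₁.holes ∪ t₂.holes
  | .tree t => t.holes
  | .hole α => {α}

mutual
/-- Expressions of the calculus (with holes embedded via values). -/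
inductive Expr : Type where
  | var (x : ℕ) : Expr
  | val (v : Val) : Expr
  | plus (e₁ e₂ : Expr) : Expr
  | ite (e₁ e₂ e₃ : Expr) : Expr
  | app (e₁ e₂ : Expr) : Expr
  | pair (e₁ e₂ : Expr) : Expr
  | node (t : Ty) (e₁ e₂ e₃ : Expr) : Expr

/-- Values: n | b | λx.e | (v,v) | Leaf t | Node t v v v | ν[α] (hole). -/
inductive Val : Type where
  | int (n : ℤ) : Val
  | bool (b : Bool) : Val
  | lam (x : ℕ) (e : Expr) : Val
  | pair (v₁ v₂ : Val) : Val
  | leaf (t : Ty) : Val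
  | node (t : Ty) (v₁ v₂ v₃ : Val) : Val
  | hole (ν α : ℕ) : Val
end

/-- The dynamic type of a value. -/
def typeof : Val → Ty
  | .int _ => .int
  | .bool _ => .bool
  | .lam _ _ => .fn
  | .pair v₁ v₂ => .prod (typeof v₁) (typeof v₂)
  | .leaf t => .tree t
  | .node t _ _ _ => .tree t
  | .hole _ α => .hole α

/-- A value substitution: a (partial) map from value holes to values. -/
abbrev VSubst := ℕ → Option Val

/-- The non-deterministic generation procedure gen(t, σ), as a relation. -/
inductive Gen (σ : TSub) : Ty → Val → Prop where
  | int (n : ℤ) : Gen σ .int (.int n)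
  | bool (b : Bool) : Gen σ .bool (.bool b)
  | prod {t₁ t₂ v₁ v₂} : Gen σ t₁ v₁ → Gen σ t₂ v₂ →
      Gen σ (.prod t₁ t₂) (.pair v₁ v₂)
  | leaf (t : Ty) : Gen σ (.tree t) (.leaf t)
  | node {t v₁ v₂ v₃} : Gen σ t v₁ → Gen σ (.tree t) v₂ → Gen σ (.tree t) v₃ →
      Gen σ (.tree t) (.node t v₁ v₂ v₃)
  | fn (x ν α : ℕ) : Gen σ .fn (.lam x (.val (.hole ν α)))
  | holeBound {α t v} : σ α = some t → Gen σ t v → Gen σ (.hole α) v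
  | holeFree {α} (ν : ℕ) : σ α = none → Gen σ (.hole α) (.hole ν α)

/-- σ' extends σ: σ' preserves all bindings of σ. -/
def Extends (σ σ' : TSub) : Prop := ∀ α t, σ α = some t → σ' α = some t

/-- unify(C, σ) = σ' : σ' extends σ and equates every constraint in C. -/
def Unify (C : List (Ty × Ty)) (σ σ' : TSub) : Prop :=
  Extends σ σ' ∧ ∀ p ∈ C, Ty.subst σ' p.1 = Ty.subst σ' p.2

/-- Result of narrowing: a value, or the stuck state. -/
inductive Res : Type where
  | ok (v : Val) : Res
  | stuck : Res

/-- The narrow procedure, as an inductive relation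
    narrow(v, t, ρ, σ) = ⟨r, ρ', σ'⟩. -/
inductive Narrow : Val → Ty → VSubst → TSub → Res → VSubst → TSub → Prop where
  | int {n ρ σ} : Narrow (.int n) .int ρ σ (.ok (.int n)) ρ σ
  | bool {b ρ σ} : Narrow (.bool b) .bool ρ σ (.ok (.bool b)) ρ σ
  | lam {x e ρ σ} : Narrow (.lam x e) .fn ρ σ (.ok (.lam x e)) ρ σ
  | pair {v₁ v₂ t₁ t₂ ρ σ σ' σ''} :
      Unify [(typeof v₁, t₁)] σ σ' → Unify [(typeof v₂, t₂)] σ' σ'' →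
      Narrow (.pair v₁ v₂) (.prod t₁ t₂) ρ σ (.ok (.pair v₁ v₂)) ρ σ''
  | leaf {t₁ t₂ ρ σ σ'} : Unify [(t₁, t₂)] σ σ' →
      Narrow (.leaf t₁) (.tree t₂) ρ σ (.ok (.leaf t₁)) ρ σ'
  | node {t₁ t₂ v₁ v₂ v₃ ρ σ σ'} : Unify [(t₁, t₂)] σ σ' →
      Narrow (.node t₁ v₁ v₂ v₃) (.tree t₂) ρ σ (.ok (.node t₁ v₁ v₂ v₃)) ρ σ'
  | holeBound {ν α t v ρ σ σ'} : ρ ν = some v →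
      Unify [(.hole α, t), (.hole α, typeof v)] σ σ' →
      Narrow (.hole ν α) t ρ σ (.ok v) ρ σ'
  | holeBoundStuck {ν α t v ρ σ} : ρ ν = some v →
      (¬ ∃ σ', Unify [(.hole α, t), (.hole α, typeof v)] σ σ') →
      Narrow (.hole ν α) t ρ σ .stuck ρ σ
  | holeFree {ν α t v ρ σ σ'} : ρ ν = none →
      Unify [(.hole α, t)] σ σ' → Gen σ' t v →
      Narrow (.hole ν α) t ρ σ (.ok v)
        (fun m => if m = ν then some v else ρ m) σ'
  | mismatch {v t ρ σ} : Narrow v t ρ σ .stuck ρ σ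

mutual
/-- Capture-naive substitution of a value for a variable in an expression. -/
def substE (x : ℕ) (w : Val) : Expr → Expr
  | .var y => if y = x then .val w else .var y
  | .val v => .val (substV x w v)
  | .plus e₁ e₂ => .plus (substE x w e₁) (substE x w e₂)
  | .ite e₁ e₂ e₃ => .ite (substE x w e₁) (substE x w e₂) (substE x w e₃)
  | .app e₁ e₂ => .app (substE x w e₁) (substE x w e₂)
  | .pair e₁ e₂ => .pair (substE x w e₁) (substE x w e₂)
  | .node t e₁ e₂ e₃ => .node t (substE x w e₁) (substE x w e₂) (substE x w e₃)

def substV (x : ℕ) (w : Val) : Val → Val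
  | .int n => .int n
  | .bool b => .bool b
  | .lam y e => if y = x then .lam y e else .lam y (substE x w e)
  | .pair v₁ v₂ => .pair (substV x w v₁) (substV x w v₂)
  | .leaf t => .leaf t
  | .node t v₁ v₂ v₃ => .node t (substV x w v₁) (substV x w v₂) (substV x w v₃)
  | .hole ν α => .hole ν α
end

/-- Small-step reduction on configurations ⟨e, ρ, σ⟩; the target
    expression `none` denotes the stuck state. -/
inductive Step : Expr → VSubst → TSub → Option Expr → VSubst → TSub → Prop where
  | plus {v₁ v₂ n₁ n₂ ρ σ ρ₁ σ₁ ρ₂ σ₂} :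
      Narrow v₁ .int ρ σ (.ok (.int n₁)) ρ₁ σ₁ →
      Narrow v₂ .int ρ₁ σ₁ (.ok (.int n₂)) ρ₂ σ₂ →
      Step (.plus (.val v₁) (.val v₂)) ρ σ (some (.val (.int (n₁ + n₂)))) ρ₂ σ₂
  | plusStuck₁ {v₁ v₂ ρ σ ρ₁ σ₁} :
      Narrow v₁ .int ρ σ .stuck ρ₁ σ₁ →
      Step (.plus (.val v₁) (.val v₂)) ρ σ none ρ₁ σ₁
  | plusStuck₂ {v₁ v₂ w₁ ρ σ ρ₁ σ₁ ρ₂ σ₂} :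
      Narrow v₁ .int ρ σ (.ok w₁) ρ₁ σ₁ →
      Narrow v₂ .int ρ₁ σ₁ .stuck ρ₂ σ₂ →
      Step (.plus (.val v₁) (.val v₂)) ρ σ none ρ₂ σ₂
  | iteTrue {v e₂ e₃ ρ σ ρ' σ'} :
      Narrow v .bool ρ σ (.ok (.bool true)) ρ' σ' →
      Step (.ite (.val v) e₂ e₃) ρ σ (some e₂) ρ' σ'
  | iteFalse {v e₂ e₃ ρ σ ρ' σ'} :
      Narrow v .bool ρ σ (.ok (.bool false)) ρ' σ' →
      Step (.ite (.val v) e₂ e₃) ρ σ (some e₃) ρ' σ'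
  | iteStuck {v e₂ e₃ ρ σ ρ' σ'} :
      Narrow v .bool ρ σ .stuck ρ' σ' →
      Step (.ite (.val v) e₂ e₃) ρ σ none ρ' σ'
  | app {v₁ v₂ x e ρ σ ρ' σ'} :
      Narrow v₁ .fn ρ σ (.ok (.lam x e)) ρ' σ' →
      Step (.app (.val v₁) (.val v₂)) ρ σ (some (substE x v₂ e)) ρ' σ'
  | appNotFn {v₁ v₂ w ρ σ ρ' σ'} :
      Narrow v₁ .fn ρ σ (.ok w) ρ' σ' → (∀ x e, w ≠ .lam x e) →
      Step (.app (.val v₁) (.val v₂)) ρ σ none ρ' σ'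
  | appStuck {v₁ v₂ ρ σ ρ' σ'} :
      Narrow v₁ .fn ρ σ .stuck ρ' σ' →
      Step (.app (.val v₁) (.val v₂)) ρ σ none ρ' σ'
  | pairVal {v₁ v₂ ρ σ} :
      Step (.pair (.val v₁) (.val v₂)) ρ σ (some (.val (.pair v₁ v₂))) ρ σ
  | nodeVal {t v₁ v₂ v₃ w₁ w₂ w₃ ρ σ ρ₁ σ₁ ρ₂ σ₂ ρ₃ σ₃} :
      Narrow v₁ t ρ σ (.ok w₁) ρ₁ σ₁ →
      Narrow v₂ (.tree t) ρ₁ σ₁ (.ok w₂) ρ₂ σ₂ →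
      Narrow v₃ (.tree t) ρ₂ σ₂ (.ok w₃) ρ₃ σ₃ →
      Step (.node t (.val v₁) (.val v₂) (.val v₃)) ρ σ
        (some (.val (.node t w₁ w₂ w₃))) ρ₃ σ₃
  | nodeStuck {t v₁ v₂ v₃ ρ σ ρ' σ'} :
      Narrow v₁ t ρ σ .stuck ρ' σ' →
      Step (.node t (.val v₁) (.val v₂) (.val v₃)) ρ σ none ρ' σ'
  | ctxPlus₁ {e₁ e₂ oe ρ σ ρ' σ'} :
      Step e₁ ρ σ oe ρ' σ' →
      Step (.plus e₁ e₂) ρ σ (oe.map (fun e₁' => .plus e₁' e₂)) ρ' σ'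
  | ctxPlus₂ {v₁ e₂ oe ρ σ ρ' σ'} :
      Step e₂ ρ σ oe ρ' σ' →
      Step (.plus (.val v₁) e₂) ρ σ (oe.map (fun e₂' => .plus (.val v₁) e₂')) ρ' σ'
  | ctxIte {e₁ e₂ e₃ oe ρ σ ρ' σ'} :
      Step e₁ ρ σ oe ρ' σ' →
      Step (.ite e₁ e₂ e₃) ρ σ (oe.map (fun e₁' => .ite e₁' e₂ e₃)) ρ' σ'
  | ctxApp₁ {e₁ e₂ oe ρ σ ρ' σ'} :
      Step e₁ ρ σ oe ρ' σ' →
      Step (.app e₁ e₂) ρ σ (oe.map (fun e₁' => .app e₁' e₂)) ρ' σ'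
  | ctxApp₂ {v₁ e₂ oe ρ σ ρ' σ'} :
      Step e₂ ρ σ oe ρ' σ' →
      Step (.app (.val v₁) e₂) ρ σ (oe.map (fun e₂' => .app (.val v₁) e₂')) ρ' σ'
  | ctxPair₁ {e₁ e₂ oe ρ σ ρ' σ'} :
      Step e₁ ρ σ oe ρ' σ' →
      Step (.pair e₁ e₂) ρ σ (oe.map (fun e₁' => .pair e₁' e₂)) ρ' σ'
  | ctxPair₂ {v₁ e₂ oe ρ σ ρ' σ'} :
      Step e₂ ρ σ oe ρ' σ' →
      Step (.pair (.val v₁) e₂) ρ σ (oe.map (fun e₂' => .pair (.val v₁) e₂')) ρ' σ'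
  | ctxNode₁ {t e₁ e₂ e₃ oe ρ σ ρ' σ'} :
      Step e₁ ρ σ oe ρ' σ' →
      Step (.node t e₁ e₂ e₃) ρ σ (oe.map (fun e₁' => .node t e₁' e₂ e₃)) ρ' σ'

/-- A configuration: an expression (or `none` for stuck), a value
    substitution and a type substitution. -/
abbrev Conf := Option Expr × VSubst × TSub

/-- The step relation on configurations. -/
def StepC : Conf → Conf → Prop
  | (some e, ρ, σ), (oe', ρ', σ') => Step e ρ σ oe' ρ' σ'
  | (none, _, _), _ => False

/-- The empty value substitution. -/
def emptyV : VSubst := fun _ => none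
/-- The empty type substitution. -/
def emptyT : TSub := fun _ => none

theorem Extends.refl (σ : TSub) : Extends σ σ := fun _ _ h => h

theorem Extends.trans {σ₁ σ₂ σ₃ : TSub} (h₁ : Extends σ₁ σ₂) (h₂ : Extends σ₂ σ₃) :
    Extends σ₁ σ₃ := fun α t h => h₂ α t (h₁ α t h)

theorem Narrow.tsub_extends {v : Val} {t : Ty} {ρ ρ' : VSubst} {σ σ' : TSub} {r : Res}
    (h : Narrow v t ρ σ r ρ' σ') : Extends σ σ' := by
  cases h with
  | int | bool | lam | holeBoundStuck | mismatch => exact Extends.refl σ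
  | pair h₁ h₂ => exact h₁.1.trans h₂.1
  | leaf h | node h => exact h.1
  | holeBound _ h => exact h.1
  | holeFree _ h _ => exact h.1

theorem Step.tsub_extends {e : Expr} {oe' : Option Expr} {ρ ρ' : VSubst} {σ σ' : TSub}
    (h : Step e ρ σ oe' ρ' σ') : Extends σ σ' := by
  induction h with
  | plus h₁ h₂ | plusStuck₂ h₁ h₂ => exact h₁.tsub_extends.trans h₂.tsub_extends
  | plusStuck₁ h | iteTrue h | iteFalse h | iteStuck h | app h | appStuck h | nodeStuck h =>
    exact h.tsub_extends
  | appNotFn h _ => exact h.tsub_extends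
  | pairVal => exact Extends.refl _
  | nodeVal h₁ h₂ h₃ =>
    exact (h₁.tsub_extends.trans h₂.tsub_extends).trans h₃.tsub_extends
  | ctxPlus₁ _ ih | ctxPlus₂ _ ih | ctxIte _ ih | ctxApp₁ _ ih | ctxApp₂ _ ih
  | ctxPair₁ _ ih | ctxPair₂ _ ih | ctxNode₁ _ ih => exact ih

/-- Single-step type-substitution monotonicity: if
⟨e, ρ, σ⟩ steps to ⟨e', ρ', σ'⟩ then σ' extends σ; consequently, if the
partial input type (the resolved type of any hole α) changes across the
step, the later substitution strictly extends the earlier one. -/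
theorem step_tsub_monotone (e : Expr) (ρ ρ' : VSubst) (σ σ' : TSub)
    (oe' : Option Expr) (h : Step e ρ σ oe' ρ' σ') :
    Extends σ σ' ∧
    (∀ α : ℕ, Ty.subst σ' (.hole α) ≠ Ty.subst σ (.hole α) →
      Extends σ σ' ∧ σ' ≠ σ) := by
  refine ⟨h.tsub_extends, fun α hα => ⟨h.tsub_extends, ?_⟩⟩
  rintro rfl
  exact hα rfl
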